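/- (Value function equals equilibrium payoff.) For every time t ∈ {1,…,T}, every player i, every history a_{1:t-1} ∈ 𝒜^{t-1} and every type x^i with π*_t[a_{1:t-1}](x^i) := ∑_{x^{-i}} π*_t[a_{1:t-1}](x^{-i},x^i) > 0, one has V^i_t(π*_t[a_{1:t-1}], x^i) = E^{β*_{t:T}, π*_t}[∑_{n=t}^T R^i_n | a_{1:t-1}, x^i], where the right-hand side is the finite sum ∑_{x^{-i}} ∑_{a_{t:T}} (π*_t[a_{1:t-1}](x^{-i},x^i)/π*_t[a_{1:t-1}](x^i)) · ∏_{n=t}^T ∏_{j=1}^N β^{*,j}_n(a^j_n|a_{1:n-1},x^j) · ∑_{n=t}^T R^i_n(x, a_n), with a_{1:n-1} denoting the concatenation of the given a_{1:t-1} with a_{t:n-1}. -/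

import Mathlib

open Finset

/-! ## Common setup

`N` players with private types `X i` and actions `A i`, all nonempty and finite.
A history is a `List (∀ i, A i)` of past joint actions in chronological order;
the kernel used at time `n` is the one applied to histories of length `n - 1`. -/

noncomputable section

variable {N : ℕ} {X A : Fin N → Type*}

/-- Combine player `i`'s private type `xi` with the profile `xm` of the other
players' private types into a full type profile `x = (x^i, x^{-i})`. -/
def combine (i : Fin N) (xi : X i) (xm : ∀ j : {j : Fin N // j ≠ i}, X j.1)
    (j : Fin N) : X j :=
  if h : j = i then h.symm ▸ xi else xm ⟨j, h⟩

section

variable [∀ i, Fintype (X i)] [∀ i, Fintype (A i)]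

/-- `π` is a belief on the product type: nonnegative and summing to one. -/
def IsBelief (π : (∀ i, X i) → ℝ) : Prop :=
  (∀ x, 0 ≤ π x) ∧ ∑ x, π x = 1

/-- `γ` is a prescription profile: each `γ i (x^i)` is a probability vector on `A i`. -/
def IsPresc (γ : ∀ i, X i → A i → ℝ) : Prop :=
  ∀ i xi, (∀ ai, 0 ≤ γ i xi ai) ∧ ∑ ai, γ i xi ai = 1

/-- `σi` is a behavioral strategy kernel of player `i`: for each history and
private type, a probability vector on `A i`. -/
def IsKernel (i : Fin N) (σi : List (∀ j, A j) → X i → A i → ℝ) : Prop :=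
  ∀ h xi, (∀ ai, 0 ≤ σi h xi ai) ∧ ∑ ai, σi h xi ai = 1

/-- Likelihood `L(π,γ,a) = ∑_x π(x) ∏_i γ^i(a^i|x^i)`. -/
def like (π : (∀ i, X i) → ℝ) (γ : ∀ i, X i → A i → ℝ) (a : ∀ i, A i) : ℝ :=
  ∑ x, π x * ∏ i, γ i (x i) (a i)

/-- Belief update `F(π,γ,a)`: Bayes' rule when the likelihood is positive,
and `π` itself otherwise. -/
def bUpdate (π : (∀ i, X i) → ℝ) (γ : ∀ i, X i → A i → ℝ) (a : ∀ i, A i) :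
    (∀ i, X i) → ℝ :=
  if 0 < like π γ a then fun x => π x * (∏ i, γ i (x i) (a i)) / like π γ a else π

/-- Marginal probability `π(x^i)` of player `i`'s type `xi` under belief `π`. -/
def marginal (π : (∀ i, X i) → ℝ) (i : Fin N) (xi : X i) : ℝ :=
  ∑ xm : ∀ j : {j : Fin N // j ≠ i}, X j.1, π (combine i xi xm)

end

end
section

variable {N : ℕ} {X A : Fin N → Type*}
variable [∀ i, Fintype (X i)] [∀ i, Fintype (A i)]

/-- Forward recursion of the common belief: `piStar θ t π h` is the belief obtained
from belief `π` at time `t` after observing the joint-action history `h`, using the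
equilibrium generating function `θ`.  Thus `piStar θ 1 Q h = π*_{|h|+1}[h]`. -/
noncomputable def piStar (θ : ℕ → ((∀ i, X i) → ℝ) → ∀ i, X i → A i → ℝ) :
    ℕ → ((∀ i, X i) → ℝ) → List (∀ i, A i) → (∀ i, X i) → ℝ
  | _, π, [] => π
  | t, π, a :: h => piStar θ (t + 1) (bUpdate π (θ t π) a) h

/-- Equilibrium strategy `β*` from the forward recursion:
`β*^j_t(a^j|a_{1:t-1},x^j) = θ_t[π*_t[a_{1:t-1}]]^j(a^j|x^j)` where `t - 1` is the
length of the history. -/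
noncomputable def betaStar (θ : ℕ → ((∀ i, X i) → ℝ) → ∀ i, X i → A i → ℝ)
    (Q : (∀ i, X i) → ℝ) (j : Fin N) (h : List (∀ i, A i)) (xj : X j) (aj : A j) : ℝ :=
  θ (h.length + 1) (piStar θ 1 Q h) j xj aj

/-- The strategy profile in which player `i` uses `βi` and every other player `j`
uses `σ j`. -/
def unilateral (i : Fin N) (βi : List (∀ j, A j) → X i → A i → ℝ)
    (σ : ∀ j, List (∀ k, A k) → X j → A j → ℝ) (j : Fin N) :
    List (∀ k, A k) → X j → A j → ℝ :=
  if h : j = i then (fun hist xj aj => βi hist (h ▸ xj) (h ▸ aj)) else σ j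

/-- Probability weight of a future joint-action path `f` of length `m` following the
history `h`, given the state `x`, under the strategy profile `σ`:
`∏_k ∏_j σ^j(f_k^j | h f_{0:k-1}, x^j)`. -/
def pathWeight (σ : ∀ j, List (∀ k, A k) → X j → A j → ℝ)
    (h : List (∀ k, A k)) (x : ∀ j, X j) {m : ℕ} (f : Fin m → ∀ k, A k) : ℝ :=
  ∏ k : Fin m, ∏ j, σ j (h ++ (List.ofFn f).take (k : ℕ)) (x j) (f k j)

/-- Total reward of player `i` along the action path `f`, starting at time `s`:
`∑_{n=s}^{s+m-1} R^i_n(x, a_n)`. -/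
def rewardSum (R : Fin N → ℕ → (∀ j, X j) → (∀ j, A j) → ℝ)
    (i : Fin N) (s : ℕ) (x : ∀ j, X j) {m : ℕ} (f : Fin m → ∀ j, A j) : ℝ :=
  ∑ k : Fin m, R i (s + (k : ℕ)) x (f k)

/-- The conditional measure on `(x^{-i}, future actions)` given `(h, x^i)`:
root belief `π(x^{-i}|x^i)` times the path weight under `σ`. -/
noncomputable def muMeas (π : (∀ j, X j) → ℝ)
    (σ : ∀ j, List (∀ k, A k) → X j → A j → ℝ)
    (h : List (∀ k, A k)) (i : Fin N) (xi : X i)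
    (xm : ∀ j : {j : Fin N // j ≠ i}, X j.1) {m : ℕ} (f : Fin m → ∀ k, A k) : ℝ :=
  (π (combine i xi xm) / marginal π i xi) * pathWeight σ h (combine i xi xm) f

/-- Conditional expected reward-to-go of player `i` from time `s` over `m` stages,
given history `h` and own type `xi`, with root belief `π` and strategy profile `σ`:
`E^{σ,π}[∑_{n=s}^{s+m-1} R^i_n | h, x^i]`. -/
noncomputable def condExp (R : Fin N → ℕ → (∀ j, X j) → (∀ j, A j) → ℝ)
    (i : Fin N) (s m : ℕ) (π : (∀ j, X j) → ℝ)
    (σ : ∀ j, List (∀ k, A k) → X j → A j → ℝ)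
    (h : List (∀ k, A k)) (xi : X i) : ℝ :=
  ∑ xm : ∀ j : {j : Fin N // j ≠ i}, X j.1, ∑ f : Fin m → ∀ k, A k,
    muMeas π σ h i xi xm f * rewardSum R i s (combine i xi xm) f

/-- Stage objective `W(γ^i)` of the backward recursion at time `t`, belief `π`,
player `i` with type `xi`, when player `i` uses the probability vector `p` on `A i`
and the others use the prescriptions `γt`. -/
noncomputable def stageW (R : Fin N → ℕ → (∀ j, X j) → (∀ j, A j) → ℝ)
    (V : ∀ i : Fin N, ℕ → ((∀ j, X j) → ℝ) → X i → ℝ) (t : ℕ)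
    (π : (∀ j, X j) → ℝ) (γt : ∀ j, X j → A j → ℝ) (i : Fin N) (xi : X i)
    (p : A i → ℝ) : ℝ :=
  ∑ xm : ∀ j : {j : Fin N // j ≠ i}, X j.1, ∑ a : ∀ j, A j,
    (π (combine i xi xm) / marginal π i xi) * p (a i) *
      (∏ j ∈ Finset.univ.erase i, γt j (combine i xi xm j) (a j)) *
      (R i t (combine i xi xm) a + V i (t + 1) (bUpdate π γt a) xi)

/-- The backward-recursion conditions on the value functions `V` and equilibrium
generating function `θ`: `V^i_{T+1} ≡ 0`, and at every time `t ∈ {1,…,T}`, belief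
`π`, player `i` and type `xi` of positive marginal, the prescription `θ t π i xi`
maximizes the stage objective among probability vectors on `A i`, and `V^i_t(π,x^i)`
is the corresponding maximum value. -/
noncomputable def BackwardOK (T : ℕ)
    (R : Fin N → ℕ → (∀ j, X j) → (∀ j, A j) → ℝ)
    (V : ∀ i : Fin N, ℕ → ((∀ j, X j) → ℝ) → X i → ℝ)
    (θ : ℕ → ((∀ j, X j) → ℝ) → ∀ j, X j → A j → ℝ) : Prop :=
  (∀ i π xi, V i (T + 1) π xi = 0) ∧
  ∀ t, 1 ≤ t → t ≤ T → ∀ π : (∀ j, X j) → ℝ, IsBelief π →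
    ∀ i xi, 0 < marginal π i xi →
      (∀ p : A i → ℝ, (∀ ai, 0 ≤ p ai) → (∑ ai, p ai) = 1 →
        stageW R V t π (θ t π) i xi p ≤ stageW R V t π (θ t π) i xi (θ t π i xi)) ∧
      V i t π xi = stageW R V t π (θ t π) i xi (θ t π i xi)

end

section

variable {N : ℕ} {X A : Fin N → Type*}

theorem combine_self (i : Fin N) (xi : X i) (xm : ∀ j : {j : Fin N // j ≠ i}, X j.1) :
    combine i xi xm i = xi := by
  simp [combine]

theorem combine_injective (i : Fin N) (xi : X i) :
    Function.Injective (combine (X := X) i xi) := by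
  intro xm ym hxy
  funext j
  have hj := congrFun hxy j.1
  simpa [combine, j.2] using hj

theorem pathWeight_cons (σ : ∀ j, List (∀ k, A k) → X j → A j → ℝ)
    (h : List (∀ k, A k)) (x : ∀ j, X j) {m : ℕ} (a : ∀ k, A k) (f : Fin m → ∀ k, A k) :
    pathWeight σ h x (Fin.cons a f : Fin (m + 1) → ∀ k, A k) =
      (∏ j, σ j h (x j) (a j)) * pathWeight σ (h ++ [a]) x f := by
  simp [pathWeight, Fin.prod_univ_succ, List.ofFn_succ]

theorem rewardSum_cons (R : Fin N → ℕ → (∀ j, X j) → (∀ j, A j) → ℝ)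
    (i : Fin N) (s : ℕ) (x : ∀ j, X j) {m : ℕ} (a : ∀ j, A j) (f : Fin m → ∀ j, A j) :
    rewardSum R i s x (Fin.cons a f : Fin (m + 1) → ∀ j, A j) =
      R i s x a + rewardSum R i (s + 1) x f := by
  simp [rewardSum, Fin.sum_univ_succ, Nat.add_assoc, Nat.add_comm 1]

theorem sum_fin_succ_arrow {α : Type*} [Fintype α] {m : ℕ} (g : (Fin (m + 1) → α) → ℝ) :
    ∑ f, g f = ∑ a, ∑ f : Fin m → α, g (Fin.cons a f) := by
  rw [← Fintype.sum_prod_type' (f := fun a (f : Fin m → α) => g (Fin.cons a f))]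
  exact (Fintype.sum_equiv (Fin.consEquiv fun _ : Fin (m + 1) => α) _ _ fun _ => rfl).symm

section Actions

variable [∀ i, Fintype (A i)]

theorem IsPresc.sum_prod_eq_one {γ : ∀ i, X i → A i → ℝ} (hγ : IsPresc γ) (x : ∀ i, X i) :
    ∑ a : ∀ i, A i, ∏ i, γ i (x i) (a i) = 1 := by
  rw [← Fintype.piFinset_univ, ← Finset.prod_univ_sum]
  exact Finset.prod_eq_one fun i _ => (hγ i (x i)).2

theorem IsPresc.prod_nonneg {γ : ∀ i, X i → A i → ℝ} (hγ : IsPresc γ) (x : ∀ i, X i)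
    (a : ∀ i, A i) : 0 ≤ ∏ i, γ i (x i) (a i) :=
  Finset.prod_nonneg fun i _ => (hγ i (x i)).1 (a i)

theorem sum_pathWeight_eq_one {σ : ∀ j, List (∀ k, A k) → X j → A j → ℝ}
    (hσ : ∀ h, IsPresc fun j => σ j h) (x : ∀ j, X j) (m : ℕ) (h : List (∀ k, A k)) :
    ∑ f : Fin m → ∀ k, A k, pathWeight σ h x f = 1 := by
  induction m generalizing h with
  | zero => simp [pathWeight]
  | succ m ih =>
    simp only [sum_fin_succ_arrow, pathWeight_cons, ← Finset.mul_sum, ih, mul_one]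
    exact (hσ h).sum_prod_eq_one x

/-- Expected reward-to-go over `m` stages from time `s` after history `h`, given the full
type profile `x`. -/
noncomputable def payoffToGo (R : Fin N → ℕ → (∀ j, X j) → (∀ j, A j) → ℝ) (i : Fin N)
    (σ : ∀ j, List (∀ k, A k) → X j → A j → ℝ) (s m : ℕ) (h : List (∀ k, A k))
    (x : ∀ j, X j) : ℝ :=
  ∑ f : Fin m → ∀ k, A k, pathWeight σ h x f * rewardSum R i s x f

theorem payoffToGo_succ (R : Fin N → ℕ → (∀ j, X j) → (∀ j, A j) → ℝ) (i : Fin N)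
    {σ : ∀ j, List (∀ k, A k) → X j → A j → ℝ} (hσ : ∀ h, IsPresc fun j => σ j h)
    (s m : ℕ) (h : List (∀ k, A k)) (x : ∀ j, X j) :
    payoffToGo R i σ s (m + 1) h x =
      ∑ a, (∏ j, σ j h (x j) (a j)) *
        (R i s x a + payoffToGo R i σ (s + 1) m (h ++ [a]) x) := by
  simp only [payoffToGo, sum_fin_succ_arrow, pathWeight_cons, rewardSum_cons]
  refine Finset.sum_congr rfl fun a _ => ?_
  simp only [mul_add, mul_assoc, Finset.sum_add_distrib, ← Finset.mul_sum, ← Finset.sum_mul,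
    sum_pathWeight_eq_one hσ, one_mul]

end Actions

section Beliefs

variable [∀ i, Fintype (X i)]

theorem sum_combine_le {g : (∀ j, X j) → ℝ} (hg : ∀ x, 0 ≤ g x) (i : Fin N) (xi : X i) :
    ∑ xm, g (combine i xi xm) ≤ ∑ x, g x := by
  classical
  rw [← Finset.sum_image (f := g) (combine_injective i xi).injOn]
  exact Finset.sum_le_sum_of_subset_of_nonneg (Finset.subset_univ _) fun x _ _ => hg x

theorem piStar_concat (θ : ℕ → ((∀ j, X j) → ℝ) → ∀ j, X j → A j → ℝ)
    (h : List (∀ j, A j)) (a : ∀ j, A j) (t : ℕ) (π : (∀ i, X i) → ℝ) :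
    piStar θ t π (h ++ [a]) =
      bUpdate (piStar θ t π h) (θ (t + h.length) (piStar θ t π h)) a := by
  induction h generalizing t π with
  | nil => rfl
  | cons b h ih =>
    simp only [List.cons_append, piStar, ih, List.length_cons]
    rw [Nat.add_assoc, Nat.add_comm 1]

variable [∀ i, Fintype (A i)]

theorem IsBelief.bUpdate {π : (∀ i, X i) → ℝ} (hπ : IsBelief π) {γ : ∀ i, X i → A i → ℝ}
    (hγ : IsPresc γ) (a : ∀ i, A i) : IsBelief (bUpdate π γ a) := by
  unfold _root_.bUpdate
  split_ifs with hL
  · refine ⟨fun x => div_nonneg (mul_nonneg (hπ.1 x) (hγ.prod_nonneg x a)) hL.le, ?_⟩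
    rw [← Finset.sum_div]
    exact div_self hL.ne'
  · exact hπ

theorem IsBelief.piStar {θ : ℕ → ((∀ j, X j) → ℝ) → ∀ j, X j → A j → ℝ}
    (hθ : ∀ t π, IsPresc (θ t π)) (h : List (∀ j, A j)) (t : ℕ) {π : (∀ i, X i) → ℝ}
    (hπ : IsBelief π) : IsBelief (piStar θ t π h) := by
  induction h generalizing t π with
  | nil => exact hπ
  | cons a h ih => exact ih (t + 1) (hπ.bUpdate (hθ t π) a)

theorem condExp_eq_sum_payoffToGo (R : Fin N → ℕ → (∀ j, X j) → (∀ j, A j) → ℝ)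
    (i : Fin N) (s m : ℕ) (π : (∀ j, X j) → ℝ) (σ : ∀ j, List (∀ k, A k) → X j → A j → ℝ)
    (h : List (∀ k, A k)) (xi : X i) :
    condExp R i s m π σ h xi =
      ∑ xm, π (combine i xi xm) / marginal π i xi *
        payoffToGo R i σ s m h (combine i xi xm) := by
  simp only [condExp, muMeas, payoffToGo, Finset.mul_sum, mul_assoc]

theorem stageW_self (R : Fin N → ℕ → (∀ j, X j) → (∀ j, A j) → ℝ)
    (V : ∀ i : Fin N, ℕ → ((∀ j, X j) → ℝ) → X i → ℝ) (t : ℕ)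
    (π : (∀ j, X j) → ℝ) (γ : ∀ j, X j → A j → ℝ) (i : Fin N) (xi : X i) :
    stageW R V t π γ i xi (γ i xi) =
      ∑ xm, ∑ a : ∀ j, A j, π (combine i xi xm) / marginal π i xi *
        ((∏ j, γ j (combine i xi xm j) (a j)) *
          (R i t (combine i xi xm) a + V i (t + 1) (bUpdate π γ a) xi)) := by
  refine Finset.sum_congr rfl fun xm _ => Finset.sum_congr rfl fun a _ => ?_
  rw [← Finset.mul_prod_erase Finset.univ _ (Finset.mem_univ i), combine_self]
  ring

/-- Conditioning on the action profile `a`: if `v` agrees with the posterior average of `g`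
whenever player `i`'s type keeps positive posterior mass, then `v` may replace `g` in the
prior average of the `a`-weighted payoff. -/
theorem sum_mul_const_eq_of_posterior {π : (∀ j, X j) → ℝ} (hπ : IsBelief π)
    {γ : ∀ j, X j → A j → ℝ} (hγ : IsPresc γ) (a : ∀ j, A j) (i : Fin N) (xi : X i)
    (g : (∀ j, X j) → ℝ) (v : ℝ)
    (hv : 0 < marginal (bUpdate π γ a) i xi →
      v = ∑ xm, bUpdate π γ a (combine i xi xm) / marginal (bUpdate π γ a) i xi *
        g (combine i xi xm)) :
    ∑ xm, π (combine i xi xm) * ((∏ j, γ j (combine i xi xm j) (a j)) * v) =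
      ∑ xm, π (combine i xi xm) *
        ((∏ j, γ j (combine i xi xm j) (a j)) * g (combine i xi xm)) := by
  set w : (∀ j, X j) → ℝ := fun x => π x * ∏ j, γ j (x j) (a j) with hw
  have hw0 : ∀ x, 0 ≤ w x := fun x => mul_nonneg (hπ.1 x) (hγ.prod_nonneg x a)
  simp only [← mul_assoc]
  change ∑ xm, w (combine i xi xm) * v = ∑ xm, w (combine i xi xm) * g (combine i xi xm)
  rcases (Finset.sum_nonneg fun xm _ => hw0 (combine i xi xm)).eq_or_lt with hS | hS
  · have hz := (Finset.sum_eq_zero_iff_of_nonneg fun xm _ => hw0 (combine i xi xm)).1 hS.symm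
    exact Finset.sum_congr rfl fun xm hxm => by rw [hz xm hxm, zero_mul, zero_mul]
  · have hL : 0 < like π γ a := hS.trans_le (sum_combine_le hw0 i xi)
    have hF : bUpdate π γ a = fun x => w x / like π γ a := if_pos hL
    have hM : marginal (bUpdate π γ a) i xi =
        (∑ xm, w (combine i xi xm)) / like π γ a := by
      rw [hF, marginal, Finset.sum_div]
    rw [hv (hM ▸ div_pos hS hL), hM, hF, ← Finset.sum_mul, Finset.mul_sum]
    refine Finset.sum_congr rfl fun xm _ => ?_
    have hS0 := hS.ne'
    have hL0 := hL.ne'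
    field_simp

theorem isPresc_betaStar {θ : ℕ → ((∀ j, X j) → ℝ) → ∀ j, X j → A j → ℝ}
    (hθ : ∀ t π, IsPresc (θ t π)) (Q : (∀ j, X j) → ℝ) (h : List (∀ j, A j)) :
    IsPresc fun j => betaStar θ Q j h :=
  hθ (h.length + 1) (piStar θ 1 Q h)

theorem value_eq_condExp_of_length_add_eq {T : ℕ}
    {R : Fin N → ℕ → (∀ j, X j) → (∀ j, A j) → ℝ}
    {V : ∀ i : Fin N, ℕ → ((∀ j, X j) → ℝ) → X i → ℝ}
    {θ : ℕ → ((∀ j, X j) → ℝ) → ∀ j, X j → A j → ℝ}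
    {Q : (∀ j, X j) → ℝ} (hQ : IsBelief Q)
    (hθ : ∀ t π, IsPresc (θ t π)) (hBO : BackwardOK T R V θ) (i : Fin N) (xi : X i)
    (m : ℕ) (h : List (∀ j, A j)) (hlen : h.length + m = T)
    (hmarg : 0 < marginal (piStar θ 1 Q h) i xi) :
    V i (h.length + 1) (piStar θ 1 Q h) xi =
      condExp R i (h.length + 1) m (piStar θ 1 Q h) (betaStar θ Q) h xi := by
  induction m generalizing h with
  | zero =>
    obtain rfl : h.length = T := hlen
    simp [hBO.1, condExp, rewardSum]
  | succ m ih =>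
    have hπ : IsBelief (piStar θ 1 Q h) := hQ.piStar hθ h 1
    rw [(hBO.2 (h.length + 1) (by omega) (by omega) _ hπ i xi hmarg).2, stageW_self,
      condExp_eq_sum_payoffToGo]
    simp only [payoffToGo_succ R i (isPresc_betaStar hθ Q), Finset.mul_sum]
    refine Finset.sum_comm.trans (Eq.trans (Finset.sum_congr rfl fun a _ => ?_) Finset.sum_comm)
    have hpost : piStar θ 1 Q (h ++ [a]) =
        bUpdate (piStar θ 1 Q h) (θ (h.length + 1) (piStar θ 1 Q h)) a := by
      rw [piStar_concat, Nat.add_comm 1]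
    have key := sum_mul_const_eq_of_posterior hπ (hθ (h.length + 1) (piStar θ 1 Q h)) a i xi
      (payoffToGo R i (betaStar θ Q) (h.length + 1 + 1) m (h ++ [a]))
      (V i (h.length + 1 + 1)
        (bUpdate (piStar θ 1 Q h) (θ (h.length + 1) (piStar θ 1 Q h)) a) xi)
      (by
        intro hpos
        rw [← hpost] at hpos ⊢
        rw [← condExp_eq_sum_payoffToGo]
        simpa using ih (h ++ [a]) (by simp; omega) hpos)
    simp only [betaStar, div_mul_eq_mul_div, mul_add, Finset.sum_add_distrib,
      ← Finset.sum_div] at key ⊢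
    rw [key]

end Beliefs

end

/-- **value function equals equilibrium payoff.** For every time
`t ∈ {1,…,T}`, player `i`, history `a_{1:t-1}` (the list `h`) and type `x^i` with
positive marginal under `π*_t[a_{1:t-1}]`,
`V^i_t(π*_t[a_{1:t-1}], x^i) = E^{β*_{t:T}, π*_t}[∑_{n=t}^T R^i_n | a_{1:t-1}, x^i]`,
where the right-hand side is the conditional expected reward-to-go under the
equilibrium strategy profile `β*`. -/
theorem value_eq_equilibrium_payoff {N T : ℕ} {X A : Fin N → Type*}
    [∀ i, Fintype (X i)] [∀ i, Nonempty (X i)]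
    [∀ i, Fintype (A i)] [∀ i, Nonempty (A i)]
    (R : Fin N → ℕ → (∀ j, X j) → (∀ j, A j) → ℝ)
    (V : ∀ i : Fin N, ℕ → ((∀ j, X j) → ℝ) → X i → ℝ)
    (θ : ℕ → ((∀ j, X j) → ℝ) → ∀ j, X j → A j → ℝ)
    (Q : (∀ j, X j) → ℝ) (hQ : IsBelief Q)
    (hθ : ∀ t π, IsPresc (θ t π)) (hBO : BackwardOK T R V θ)
    (t : ℕ) (h1 : 1 ≤ t) (h2 : t ≤ T)
    (i : Fin N) (h : List (∀ j, A j)) (hlen : h.length = t - 1) (xi : X i)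
    (hmarg : 0 < marginal (piStar θ 1 Q h) i xi) :
    V i t (piStar θ 1 Q h) xi =
      condExp R i t (T - t + 1) (piStar θ 1 Q h) (betaStar θ Q) h xi := by
  obtain rfl : t = h.length + 1 := by omega
  exact value_eq_condExp_of_length_add_eq hQ hθ hBO i xi _ h (by omega) hmarg
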